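/- Let 0 < ε < 1 and consider the first-price auction instance with n = 2 bidders, both value maximizers (B_v = {1,2}), m = 2 auctions, and values v 1 1 = 1, v 2 2 = 1 − ε, v 1 2 = v 2 1 = 0. Then the deterministic strategy profile b 1 1 = b 2 1 = 0, b 1 2 = 1, b 2 2 = 0 is an equilibrium in which bidder 1 wins both auctions, the realized welfare equals 1, and the optimal welfare equals 2 − ε; hence the instance-wise price of anarchy is at most 1/(2 − ε). -/

import Mathlib

open MeasureTheory Finset
open scoped Classical

namespace FPA

variable {n m : ℕ}

/-- Bidder `i` wins auction `j` under bid profile `b`: highest bid, ties broken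
in favor of larger value, then smaller index. -/
def Wins (v b : Fin n → Fin m → ℝ) (j : Fin m) (i : Fin n) : Prop :=
  ∀ i', i' ≠ i →
    b i' j < b i j ∨ (b i' j = b i j ∧ (v i' j < v i j ∨ (v i' j = v i j ∧ i < i')))

/-- Indicator that bidder `i` wins auction `j`. -/
noncomputable def xind (v b : Fin n → Fin m → ℝ) (j : Fin m) (i : Fin n) : ℝ :=
  if Wins v b j i then 1 else 0

noncomputable def valij (v b : Fin n → Fin m → ℝ) (i : Fin n) (j : Fin m) : ℝ :=
  xind v b j i * v i j

noncomputable def payij (v b : Fin n → Fin m → ℝ) (i : Fin n) (j : Fin m) : ℝ :=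
  xind v b j i * b i j

/-- Admissible strategy: probability distribution over nonnegative bid vectors
with finite expectations. -/
def Admissible (σ : Measure (Fin m → ℝ)) : Prop :=
  IsProbabilityMeasure σ ∧ (∀ᵐ β ∂σ, ∀ j, 0 ≤ β j) ∧ ∀ j, Integrable (fun β => β j) σ

noncomputable def EValij (v : Fin n → Fin m → ℝ) (μ : Fin n → Measure (Fin m → ℝ))
    (i : Fin n) (j : Fin m) : ℝ :=
  ∫ b, valij v b i j ∂(Measure.pi μ)

noncomputable def EPayij (v : Fin n → Fin m → ℝ) (μ : Fin n → Measure (Fin m → ℝ))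
    (i : Fin n) (j : Fin m) : ℝ :=
  ∫ b, payij v b i j ∂(Measure.pi μ)

noncomputable def EVal (v : Fin n → Fin m → ℝ) (μ : Fin n → Measure (Fin m → ℝ))
    (i : Fin n) : ℝ :=
  ∑ j, EValij v μ i j

noncomputable def EPay (v : Fin n → Fin m → ℝ) (μ : Fin n → Measure (Fin m → ℝ))
    (i : Fin n) : ℝ :=
  ∑ j, EPayij v μ i j

noncomputable def EUtil (v : Fin n → Fin m → ℝ) (μ : Fin n → Measure (Fin m → ℝ))
    (i : Fin n) : ℝ :=
  EVal v μ i - EPay v μ i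

/-- A utility maximizer best responds: no admissible deviation improves expected utility. -/
def UtilBest (v : Fin n → Fin m → ℝ) (μ : Fin n → Measure (Fin m → ℝ)) (i : Fin n) : Prop :=
  ∀ σ, Admissible σ → EUtil v (Function.update μ i σ) i ≤ EUtil v μ i

/-- A value maximizer best responds: its ROI constraint holds and no admissible
deviation satisfying the ROI constraint yields more expected value. -/
def ValBest (v : Fin n → Fin m → ℝ) (μ : Fin n → Measure (Fin m → ℝ)) (i : Fin n) : Prop :=
  EPay v μ i ≤ EVal v μ i ∧
    ∀ σ, Admissible σ →
      EPay v (Function.update μ i σ) i ≤ EVal v (Function.update μ i σ) i →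
      EVal v (Function.update μ i σ) i ≤ EVal v μ i

/-- Equilibrium: all strategies admissible, every utility maximizer in `Bu` and
every value maximizer in `Bv` best responds. -/
def Equilibrium (v : Fin n → Fin m → ℝ) (Bu Bv : Finset (Fin n))
    (μ : Fin n → Measure (Fin m → ℝ)) : Prop :=
  (∀ i, Admissible (μ i)) ∧ (∀ i ∈ Bu, UtilBest v μ i) ∧ (∀ i ∈ Bv, ValBest v μ i)

/-- The rightful winner of auction `j`: the bidder with the highest value,
ties broken toward the smaller index. -/
noncomputable def rwinner [NeZero n] (v : Fin n → Fin m → ℝ) (j : Fin m) : Fin n :=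
  (Finset.univ.filter fun i => ∀ i', v i' j ≤ v i j).min' (by
    obtain ⟨i, -, hi⟩ := Finset.exists_max_image (Finset.univ : Finset (Fin n))
      (fun i => v i j) Finset.univ_nonempty
    exact ⟨i, Finset.mem_filter.mpr ⟨Finset.mem_univ _, fun i' => hi i' (Finset.mem_univ _)⟩⟩)

end FPA

open MeasureTheory Finset

/-- Values of the hard instance: `v 1 1 = 1`, `v 2 2 = 1 - ε`, off-diagonal `0`. -/
noncomputable def hardV (ε : ℝ) : Fin 2 → Fin 2 → ℝ := ![![1, 0], ![0, 1 - ε]]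

/-- The deterministic bid profile: `b 1 1 = b 2 1 = 0`, `b 1 2 = 1`, `b 2 2 = 0`. -/
noncomputable def hardB : Fin 2 → Fin 2 → ℝ := ![![0, 1], ![0, 0]]

/-- The corresponding (deterministic) strategy profile. -/
noncomputable def hardμ : Fin 2 → Measure (Fin 2 → ℝ) := fun i => Measure.dirac (hardB i)

namespace FPA

variable {n m : ℕ}

lemma xind_nonneg (v b : Fin n → Fin m → ℝ) (j : Fin m) (i : Fin n) : 0 ≤ xind v b j i := by
  unfold xind; split_ifs <;> norm_num

lemma xind_le_one (v b : Fin n → Fin m → ℝ) (j : Fin m) (i : Fin n) : xind v b j i ≤ 1 := by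
  unfold xind; split_ifs <;> norm_num

lemma measurable_xind (v : Fin n → Fin m → ℝ) (j : Fin m) (i : Fin n) :
    Measurable fun b => xind v b j i := by
  have hbid (k : Fin n) : Measurable fun b : Fin n → Fin m → ℝ => b k j :=
    (measurable_pi_apply j).comp (measurable_pi_apply k)
  have hwins : MeasurableSet {b | Wins v b j i} := by
    simp only [Wins, Set.ofPred_forall, Set.ofPred_or, Set.ofPred_and]
    refine MeasurableSet.iInter fun k => MeasurableSet.iInter fun _ => ?_
    exact (measurableSet_lt (hbid k) (hbid i)).union
      ((measurableSet_eq_fun (hbid k) (hbid i)).inter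
        ((MeasurableSet.const _).union ((MeasurableSet.const _).inter (MeasurableSet.const _))))
  exact Measurable.ite hwins measurable_const measurable_const

lemma integrable_xind (v : Fin n → Fin m → ℝ) (j : Fin m) (i : Fin n)
    (μ : Measure (Fin n → Fin m → ℝ)) [IsFiniteMeasure μ] :
    Integrable (fun b => xind v b j i) μ :=
  Integrable.of_bound (measurable_xind v j i).aestronglyMeasurable 1 <| ae_of_all _ fun b => by
    rw [Real.norm_of_nonneg (xind_nonneg v b j i)]; exact xind_le_one v b j i

lemma integrable_payij (v : Fin n → Fin m → ℝ) (μ : Fin n → Measure (Fin m → ℝ))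
    [∀ i, IsProbabilityMeasure (μ i)] (i : Fin n) (j : Fin m)
    (hint : Integrable (fun β => β j) (μ i)) :
    Integrable (fun b => payij v b i j) (Measure.pi μ) := by
  have hbid : Integrable (fun b : Fin n → Fin m → ℝ => b i j) (Measure.pi μ) :=
    (measurePreserving_eval μ i).integrable_comp_of_integrable hint
  refine hbid.bdd_mul (c := 1) (measurable_xind v j i).aestronglyMeasurable <|
    ae_of_all _ fun b => ?_
  rw [Real.norm_of_nonneg (xind_nonneg v b j i)]; exact xind_le_one v b j i

lemma EValij_le (v : Fin n → Fin m → ℝ) (μ : Fin n → Measure (Fin m → ℝ))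
    [∀ i, IsProbabilityMeasure (μ i)] (i : Fin n) (j : Fin m) (hv : 0 ≤ v i j) :
    EValij v μ i j ≤ v i j := by
  calc EValij v μ i j ≤ ∫ _, v i j ∂(Measure.pi μ) :=
        integral_mono_of_nonneg (ae_of_all _ fun b => mul_nonneg (xind_nonneg v b j i) hv)
          (integrable_const _)
          (ae_of_all _ fun b => mul_le_of_le_one_left hv (xind_le_one v b j i))
    _ = v i j := by simp

lemma admissible_dirac (β : Fin m → ℝ) (hβ : ∀ j, 0 ≤ β j) : Admissible (Measure.dirac β) := by
  refine ⟨inferInstance, ?_, fun j => ?_⟩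
  · rw [ae_dirac_eq]; exact hβ
  · exact integrable_dirac (by simp)

lemma isProbabilityMeasure_update {μ : Fin n → Measure (Fin m → ℝ)}
    (hμ : ∀ k, IsProbabilityMeasure (μ k)) (i : Fin n) {σ : Measure (Fin m → ℝ)}
    (hσ : IsProbabilityMeasure σ) (k : Fin n) :
    IsProbabilityMeasure (Function.update μ i σ k) := by
  rcases eq_or_ne k i with rfl | h
  · simpa using hσ
  · simpa [h] using hμ k

end FPA

open FPA

lemma isProbabilityMeasure_hardμ (i : Fin 2) : IsProbabilityMeasure (hardμ i) := by
  unfold hardμ; infer_instance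

lemma pi_hardμ : Measure.pi hardμ = Measure.dirac hardB := by
  have := isProbabilityMeasure_hardμ
  refine Measure.pi_eq fun s hs => ?_
  rw [Measure.dirac_apply' _ (MeasurableSet.univ_pi hs)]
  simp only [hardμ, Measure.dirac_apply' _ (hs _), Set.indicator_apply, Pi.one_apply,
    Finset.prod_ite_zero, Set.mem_univ_pi, Finset.mem_univ, true_imp_iff, Finset.prod_const_one]

lemma EVal_hardμ (v : Fin 2 → Fin 2 → ℝ) (i : Fin 2) :
    EVal v hardμ i = ∑ j, valij v hardB i j := by
  simp only [EVal, EValij, pi_hardμ, integral_dirac]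

lemma EPay_hardμ (v : Fin 2 → Fin 2 → ℝ) (i : Fin 2) :
    EPay v hardμ i = ∑ j, payij v hardB i j := by
  simp only [EPay, EPayij, pi_hardμ, integral_dirac]

lemma wins_hardB_zero (ε : ℝ) (j : Fin 2) : Wins (hardV ε) hardB j 0 := by
  intro i' hi'
  fin_cases i' <;> fin_cases j <;> simp_all [hardB, hardV]

lemma not_wins_hardB_one (ε : ℝ) (j : Fin 2) : ¬ Wins (hardV ε) hardB j 1 := by
  intro h
  have := h 0 (by decide)
  fin_cases j <;> norm_num [hardB, hardV] at this

lemma xind_hardB_zero (ε : ℝ) (j : Fin 2) : xind (hardV ε) hardB j 0 = 1 :=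
  if_pos (wins_hardB_zero ε j)

lemma xind_hardB_one (ε : ℝ) (j : Fin 2) : xind (hardV ε) hardB j 1 = 0 :=
  if_neg (not_wins_hardB_one ε j)

lemma EVal_hardμ_zero (ε : ℝ) : EVal (hardV ε) hardμ 0 = 1 := by
  simp only [EVal_hardμ, valij, xind_hardB_zero, Fin.sum_univ_two]
  simp [hardV]

lemma EVal_hardμ_one (ε : ℝ) : EVal (hardV ε) hardμ 1 = 0 := by
  simp [EVal_hardμ, valij, xind_hardB_one]

lemma valBest_hardμ_zero (ε : ℝ) : ValBest (hardV ε) hardμ 0 := by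
  refine ⟨?_, fun σ hσ _ => ?_⟩
  · simp only [EVal_hardμ_zero, EPay_hardμ, payij, xind_hardB_zero, Fin.sum_univ_two]
    simp [hardB]
  · have hprob := isProbabilityMeasure_update isProbabilityMeasure_hardμ 0 hσ.1
    rw [EVal_hardμ_zero, EVal, Fin.sum_univ_two]
    have h₀ := EValij_le (hardV ε) (Function.update hardμ 0 σ) 0 0 (by simp [hardV])
    have h₁ := EValij_le (hardV ε) (Function.update hardμ 0 σ) 0 1 (by simp [hardV])
    simp only [hardV, Matrix.cons_val_zero, Matrix.cons_val_one] at h₀ h₁ ⊢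
    linarith

/-- Bidder `1` can only win auction `1` by bidding at least the competing bid `1 > 1 - ε`, so any
deviation satisfying the ROI constraint wins it with probability zero. -/
lemma valBest_hardμ_one (ε : ℝ) (hε0 : 0 < ε) (hε1 : ε < 1) : ValBest (hardV ε) hardμ 1 := by
  refine ⟨?_, fun σ hσ hroi => ?_⟩
  · simp [EVal_hardμ_one, EPay_hardμ, payij, xind_hardB_one]
  have hprob := isProbabilityMeasure_update isProbabilityMeasure_hardμ 1 hσ.1
  set ν := Function.update hardμ 1 σ with hν
  have hν₁ : ν 1 = σ := by simp [hν]
  have hν₀ : ν 0 = Measure.dirac (hardB 0) := by simp [hν, hardμ]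
  have hopp : ∀ᵐ b ∂(Measure.pi ν), b 0 = hardB 0 := by
    refine (measurePreserving_eval ν 0).quasiMeasurePreserving.ae
      (p := fun β => β = hardB 0) ?_
    rw [hν₀, ae_dirac_eq]; rfl
  have hnonneg : ∀ᵐ b ∂(Measure.pi ν), ∀ j, 0 ≤ b 1 j := by
    refine (measurePreserving_eval ν 1).quasiMeasurePreserving.ae
      (p := fun β => ∀ j, 0 ≤ β j) ?_
    rw [hν₁]; exact hσ.2.1
  have hpay₀ : 0 ≤ EPayij (hardV ε) ν 1 0 :=
    integral_nonneg_of_ae <| hnonneg.mono fun b hb => mul_nonneg (xind_nonneg _ _ _ _) (hb 0)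
  have hpay₁ : ∫ b, xind (hardV ε) b 1 1 ∂(Measure.pi ν) ≤ EPayij (hardV ε) ν 1 1 := by
    refine integral_mono_ae (integrable_xind _ _ _ _)
      (integrable_payij _ _ _ _ (by rw [hν₁]; exact hσ.2.2 1)) (hopp.mono fun b hb => ?_)
    simp only [payij, xind]
    split_ifs with hwin
    · have hbid : b 0 1 = 1 := by simp [hb, hardB]
      rcases hwin 0 (by decide) with h | ⟨h, -⟩ <;> linarith
    · simp
  have hval₀ : EValij (hardV ε) ν 1 0 = 0 := by simp [EValij, valij, hardV]
  have hval₁ : EValij (hardV ε) ν 1 1 = (∫ b, xind (hardV ε) b 1 1 ∂(Measure.pi ν)) * (1 - ε) := by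
    simp [EValij, valij, hardV, integral_mul_const]
  have hwin : 0 ≤ ∫ b, xind (hardV ε) b 1 1 ∂(Measure.pi ν) :=
    integral_nonneg fun b => xind_nonneg _ _ _ _
  rw [EVal_hardμ_one]
  simp only [EVal, EPay, Fin.sum_univ_two, hval₀, hval₁] at hroi ⊢
  nlinarith

lemma sum_sup'_hardV (ε : ℝ) (hε1 : ε < 1) :
    (∑ j, Finset.univ.sup' Finset.univ_nonempty fun i => hardV ε i j) = 2 - ε := by
  have h₀ : (Finset.univ.sup' Finset.univ_nonempty fun i => hardV ε i 0) = 1 := by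
    apply le_antisymm
    · refine Finset.sup'_le _ _ fun i _ => ?_
      fin_cases i <;> simp [hardV]
    · exact Finset.le_sup' (fun i => hardV ε i 0) (Finset.mem_univ 0)
  have h₁ : (Finset.univ.sup' Finset.univ_nonempty fun i => hardV ε i 1) = 1 - ε := by
    apply le_antisymm
    · refine Finset.sup'_le _ _ fun i _ => ?_
      fin_cases i <;> simp [hardV, hε1.le]
    · exact Finset.le_sup' (fun i => hardV ε i 1) (Finset.mem_univ 1)
  rw [Fin.sum_univ_two, h₀, h₁]; ring

/-- With two value maximizers and the values above, the deterministic
profile `hardB` is an equilibrium in which bidder `1` (index `0`) wins both auctions,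
the realized welfare is `1`, the optimal welfare is `2 - ε`, and hence the
instance-wise price of anarchy is at most `1/(2 - ε)`. -/
theorem fpa_full_autobidding_hard_instance (ε : ℝ) (hε0 : 0 < ε) (hε1 : ε < 1) :
    FPA.Equilibrium (hardV ε) (∅ : Finset (Fin 2)) (Finset.univ : Finset (Fin 2)) hardμ ∧
    (∀ j : Fin 2, FPA.Wins (hardV ε) hardB j 0) ∧
    (∑ i, FPA.EVal (hardV ε) hardμ i) = 1 ∧
    (∑ j, Finset.univ.sup' Finset.univ_nonempty fun i => hardV ε i j) = 2 - ε ∧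
    (∑ i, FPA.EVal (hardV ε) hardμ i) /
        (∑ j, Finset.univ.sup' Finset.univ_nonempty fun i => hardV ε i j) ≤
      1 / (2 - ε) := by
  have hsum : (∑ i, EVal (hardV ε) hardμ i) = 1 := by
    rw [Fin.sum_univ_two, EVal_hardμ_zero, EVal_hardμ_one, add_zero]
  have hopt := sum_sup'_hardV ε hε1
  refine ⟨⟨fun i => ?_, by simp, fun i _ => ?_⟩, wins_hardB_zero ε, hsum, hopt, ?_⟩
  · refine admissible_dirac _ fun j => ?_
    fin_cases i <;> fin_cases j <;> simp [hardB]
  · fin_cases i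
    · exact valBest_hardμ_zero ε
    · exact valBest_hardμ_one ε hε0 hε1
  · rw [hsum, hopt]
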